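/- Let S, A be nonempty finite sets, let 𝒰 be a nonempty finite set of transition kernels P : S × A → Δ(S), and suppose there exist m ∈ ℕ, m ≥ 1, and r∞ ∈ ℕ such that for every P ∈ 𝒰 and all (s,a,s'), P(s,a)(s') = n/m for some n ∈ ℕ with n ≤ m, and r(s,a) = q/m for some q ∈ ℤ with |q| ≤ r∞. Set N = 2|S| − 1, L = 2·|S|·r∞·m^{2|S|}·4^{|S|}, and η(M) = 1/(2·N^{N/2+2}·(L+1)^N). Then for every γ ∈ [1 − η(M), 1) and every policy π, π is robust γ-discounted optimal if and only if π is robust Blackwell-optimal. -/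

import Mathlib

open Matrix

/-- The transition matrix induced by a policy `π`. -/
def policyMatrix {S A : Type*} [Fintype S] (P : S → A → S → ℝ) (π : S → A) :
    Matrix S S ℝ :=
  Matrix.of fun s s' => P s (π s) s'

/-- The reward vector induced by a policy `π`. -/
def policyReward {S A : Type*} (r : S → A → ℝ) (π : S → A) : S → ℝ :=
  fun s => r s (π s)

/-- The discounted value function of a policy `π` under kernel `P`:
`v^{π,P}_γ = (I - γ P_π)⁻¹ r_π`. -/
noncomputable def valueFn {S A : Type*} [Fintype S] [DecidableEq S]
    (r : S → A → ℝ) (P : S → A → S → ℝ) (π : S → A) (γ : ℝ) : S → ℝ :=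
  ((1 : Matrix S S ℝ) - γ • policyMatrix P π)⁻¹ *ᵥ policyReward r π

/-- The worst-case (robust) value function over a nonempty finite set `U` of kernels:
`v^{π,U}_{γ,s} = min_{P ∈ U} v^{π,P}_{γ,s}`. -/
noncomputable def robustValueFn {S A : Type*} [Fintype S] [DecidableEq S]
    (r : S → A → ℝ) (U : Finset (S → A → S → ℝ)) (hU : U.Nonempty)
    (π : S → A) (γ : ℝ) (s : S) : ℝ :=
  U.inf' hU fun P => valueFn r P π γ s

/-- `π` is robust `γ`-discounted optimal. -/
def RobustDiscountedOptimal {S A : Type*} [Fintype S] [DecidableEq S]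
    (r : S → A → ℝ) (U : Finset (S → A → S → ℝ)) (hU : U.Nonempty)
    (γ : ℝ) (π : S → A) : Prop :=
  ∀ (π' : S → A) (s : S), robustValueFn r U hU π' γ s ≤ robustValueFn r U hU π γ s

/-- `π` is robust Blackwell-optimal: robust `γ'`-discounted optimal for all `γ'` in some
`[γ₀, 1)`. -/
def RobustBlackwellOptimal {S A : Type*} [Fintype S] [DecidableEq S]
    (r : S → A → ℝ) (U : Finset (S → A → S → ℝ)) (hU : U.Nonempty)
    (π : S → A) : Prop :=
  ∃ γ₀ : ℝ, 0 ≤ γ₀ ∧ γ₀ < 1 ∧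
    ∀ γ' : ℝ, γ₀ ≤ γ' → γ' < 1 → RobustDiscountedOptimal r U hU γ' π

open Polynomial in
/-- The sum of the absolute values of the coefficients. -/
noncomputable def l1n (p : ℤ[X]) : ℝ := p.sum fun _ a => |(a : ℝ)|

section aux
open Polynomial Matrix

lemma l1n_eq (p : ℤ[X]) (n : ℕ) (h : p.natDegree < n) :
    l1n p = ∑ i ∈ Finset.range n, |(p.coeff i : ℝ)| := by
  unfold l1n
  exact Polynomial.sum_over_range' p (by simp) n h

lemma l1n_nonneg (p : ℤ[X]) : 0 ≤ l1n p := by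
  unfold l1n Polynomial.sum
  exact Finset.sum_nonneg fun _ _ => abs_nonneg _

lemma l1n_zero : l1n 0 = 0 := by simp [l1n]

lemma l1n_C (a : ℤ) : l1n (C a) = |(a : ℝ)| := by
  unfold l1n
  rw [Polynomial.sum_C_index]; simp

lemma l1n_one : l1n 1 = 1 := by
  have := l1n_C 1
  simpa using this

lemma l1n_add (p q : ℤ[X]) : l1n (p + q) ≤ l1n p + l1n q := by
  set n := max p.natDegree q.natDegree + 1
  rw [l1n_eq p n (by omega), l1n_eq q n (by omega),
    l1n_eq (p + q) n (by have := natDegree_add_le p q; omega), ← Finset.sum_add_distrib]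
  refine Finset.sum_le_sum fun i _ => ?_
  rw [coeff_add]; push_cast; exact abs_add_le _ _

lemma l1n_neg (p : ℤ[X]) : l1n (-p) = l1n p := by
  rw [l1n_eq (-p) (p.natDegree + 1) (by simp), l1n_eq p (p.natDegree + 1) (by simp)]
  simp

lemma l1n_sub (p q : ℤ[X]) : l1n (p - q) ≤ l1n p + l1n q := by
  have := l1n_add p (-q)
  rwa [l1n_neg, ← sub_eq_add_neg] at this

lemma l1n_C_mul (a : ℤ) (p : ℤ[X]) : l1n (C a * p) = |(a : ℝ)| * l1n p := by
  rw [l1n_eq (C a * p) (p.natDegree + 1) (by have := natDegree_C_mul_le a p; omega),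
    l1n_eq p (p.natDegree + 1) (by simp), Finset.mul_sum]
  simp [abs_mul]

lemma l1n_mul_X (p : ℤ[X]) : l1n (p * X) = l1n p := by
  rw [l1n_eq (p * X) (p.natDegree + 1 + 1) (by have := natDegree_mul_le (p := p) (q := X)
                                               have := natDegree_X_le (R := ℤ); omega),
    l1n_eq p (p.natDegree + 1) (by simp), Finset.sum_range_succ']
  simp

lemma l1n_mul_X_pow (p : ℤ[X]) (k : ℕ) : l1n (p * X ^ k) = l1n p := by
  induction k with
  | zero => simp
  | succ k ih => rw [pow_succ, ← mul_assoc, l1n_mul_X, ih]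

lemma l1n_sum {ι : Type*} (s : Finset ι) (f : ι → ℤ[X]) :
    l1n (∑ i ∈ s, f i) ≤ ∑ i ∈ s, l1n (f i) := by
  classical
  induction s using Finset.induction_on with
  | empty => simp [l1n_zero]
  | insert a s ha ih =>
    rw [Finset.sum_insert ha, Finset.sum_insert ha]
    have := l1n_add (f a) (∑ i ∈ s, f i)
    linarith

lemma l1n_mul (p q : ℤ[X]) : l1n (p * q) ≤ l1n p * l1n q := by
  conv_lhs => rw [← Polynomial.sum_C_mul_X_pow_eq p, Polynomial.sum, Finset.sum_mul]
  refine (l1n_sum _ _).trans ?_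
  conv_rhs => rw [l1n, Polynomial.sum, Finset.sum_mul]
  refine Finset.sum_le_sum fun i _ => le_of_eq ?_
  rw [mul_assoc, l1n_C_mul, mul_comm (X ^ i), l1n_mul_X_pow]

lemma l1n_prod {ι : Type*} (s : Finset ι) (f : ι → ℤ[X]) :
    l1n (∏ i ∈ s, f i) ≤ ∏ i ∈ s, l1n (f i) := by
  classical
  induction s using Finset.induction_on with
  | empty => simp [l1n_one]
  | insert a s ha ih =>
    rw [Finset.prod_insert ha, Finset.prod_insert ha]
    exact (l1n_mul _ _).trans (mul_le_mul_of_nonneg_left ih (l1n_nonneg _))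

lemma l1n_det {S : Type*} [Fintype S] [DecidableEq S] (M : Matrix S S ℤ[X]) :
    l1n M.det ≤ ∏ i, ∑ j, l1n (M i j) := by
  rw [← Matrix.det_transpose, Matrix.det_apply]
  refine (l1n_sum _ _).trans ?_
  have h1 : ∀ σ : Equiv.Perm S, l1n (Equiv.Perm.sign σ • ∏ i, Mᵀ (σ i) i) ≤
      ∏ i, l1n (M i (σ i)) := by
    intro σ
    rcases Int.units_eq_one_or (Equiv.Perm.sign σ) with h | h
    · rw [h, one_smul]; exact l1n_prod _ _
    · rw [h, Units.neg_smul, one_smul, l1n_neg]; exact l1n_prod _ _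
  refine (Finset.sum_le_sum fun σ _ => h1 σ).trans ?_
  rw [Finset.prod_univ_sum, Fintype.piFinset_univ]
  have := Finset.sum_map (Finset.univ : Finset (Equiv.Perm S))
    ⟨fun σ : Equiv.Perm S => (σ : S → S), DFunLike.coe_injective⟩
    (fun g : S → S => ∏ i, l1n (M i (g i)))
  simp only [Function.Embedding.coeFn_mk] at this
  rw [← this]
  exact Finset.sum_le_sum_of_subset_of_nonneg (Finset.subset_univ _)
    fun g _ _ => Finset.prod_nonneg fun i _ => l1n_nonneg _

lemma abs_aeval_le (p : ℤ[X]) (y : ℝ) (h0 : 0 ≤ y) (h1 : y ≤ 1) : |aeval y p| ≤ l1n p := by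
  rw [aeval_eq_sum_range, l1n_eq p (p.natDegree + 1) (by simp)]
  refine (Finset.abs_sum_le_sum_abs _ _).trans (Finset.sum_le_sum fun i _ => ?_)
  rw [zsmul_eq_mul, abs_mul]
  refine mul_le_of_le_one_right (abs_nonneg _) ?_
  rw [abs_pow, abs_of_nonneg h0]
  exact pow_le_one₀ h0 h1

lemma noroot (f : ℤ[X]) (y : ℝ) (h0 : 0 < y) (h1 : y ≤ 1) :
    f ≠ 0 → y * l1n f < 1 → aeval y f ≠ 0 := by
  induction f using Polynomial.recOnHorner with
  | M0 => simp
  | MC p a hp ha ih =>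
    intro _ hl he
    obtain ⟨q, rfl⟩ : X ∣ p := by rwa [X_dvd_iff]
    have hle : l1n q ≤ l1n (X * q + C a) := by
      rw [mul_comm X q]
      rw [l1n_eq q (q.natDegree + 1) (by simp), l1n_eq (q * X + C a) (q.natDegree + 1 + 1)
        (by rw [natDegree_add_C]
            have := natDegree_mul_le (p := q) (q := X)
            have := natDegree_X_le (R := ℤ); omega), Finset.sum_range_succ' _ (q.natDegree + 1)]
      simp [-eq_intCast, coeff_C_succ]
    have hq := abs_aeval_le q y h0.le h1
    rw [map_add, map_mul, aeval_X, aeval_C] at he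
    simp only [algebraMap_int_eq, eq_intCast] at he
    have ha1 : (1 : ℝ) ≤ |(a : ℝ)| := by exact_mod_cast Int.one_le_abs ha
    have : (a : ℝ) = - (y * aeval y q) := by linarith
    rw [this, abs_neg, abs_mul, abs_of_pos h0] at ha1
    nlinarith
  | MX p hp ih =>
    intro _ hl
    rw [l1n_mul_X] at hl
    simpa [h0.ne'] using ih hp hl


lemma value_poly {S A : Type*} [Fintype S] [DecidableEq S]
    (r : S → A → ℝ) (P : S → A → S → ℝ) (π : S → A)
    (hk : ∀ (s : S) (a : A), (∀ s', 0 ≤ P s a s') ∧ ∑ s', P s a s' = 1)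
    (m rinf : ℕ) (hm : 1 ≤ m)
    (hP : ∀ (s : S) (a : A) (s' : S), ∃ k : ℕ, k ≤ m ∧ P s a s' = (k : ℝ) / m)
    (hr : ∀ (s : S) (a : A), ∃ q : ℤ, r s a = (q : ℝ) / m ∧ |q| ≤ (rinf : ℤ)) (s : S) :
    ∃ num den : ℤ[X],
      l1n num ≤ Fintype.card S * (rinf * (3 * m : ℝ) ^ (Fintype.card S - 1)) ∧
      l1n den ≤ (3 * m : ℝ) ^ Fintype.card S ∧
      ∀ y : ℝ, 0 < y → y ≤ 1 → aeval y den ≠ 0 ∧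
        valueFn r P π (1 - y) s = aeval y num / aeval y den := by
  have hm0 : (0 : ℝ) < m := by exact_mod_cast hm
  choose K hKm hK using fun i j => hP i (π i) j
  choose q hq hqb using fun i => hr i (π i)
  have hKsum : ∀ i, ∑ j, (K i j : ℝ) = m := by
    intro i
    have := (hk i (π i)).2
    simp only [hK] at this
    rw [← Finset.sum_div, div_eq_one_iff_eq hm0.ne'] at this
    exact this
  let M : Matrix S S ℤ[X] := Matrix.of fun i j =>
    C (if i = j then (m : ℤ) else 0) - C (K i j : ℤ) + C (K i j : ℤ) * X
  have hrow : ∀ i, ∑ j, l1n (M i j) ≤ 3 * m := by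
    intro i
    have h1 : ∀ j, l1n (M i j) ≤ (if i = j then (m : ℝ) else 0) + 2 * K i j := by
      intro j
      have e1 := l1n_add (C (if i = j then (m : ℤ) else 0) - C (K i j : ℤ)) (C (K i j : ℤ) * X)
      have e2 := l1n_sub (C (if i = j then (m : ℤ) else 0)) (C (K i j : ℤ))
      rw [l1n_mul_X, l1n_C] at e1
      rw [l1n_C, l1n_C] at e2
      have e3 : |((K i j : ℤ) : ℝ)| = K i j := by simp
      have e4 : |(((if i = j then (m : ℤ) else 0) : ℤ) : ℝ)| = if i = j then (m : ℝ) else 0 := by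
        split_ifs <;> simp
      rw [e3] at e1 e2
      rw [e4] at e2
      have e5 : M i j = C (if i = j then (m : ℤ) else 0) - C (K i j : ℤ) + C (K i j : ℤ) * X := rfl
      rw [e5]
      linarith
    refine (Finset.sum_le_sum fun j _ => h1 j).trans ?_
    rw [Finset.sum_add_distrib, ← Finset.mul_sum, hKsum]
    simp
    linarith
  have hadj : ∀ j, l1n (M.adjugate s j) ≤ (3 * m : ℝ) ^ (Fintype.card S - 1) := by
    intro j
    rw [Matrix.adjugate_apply]
    refine (l1n_det _).trans ?_
    rw [← Finset.mul_prod_erase Finset.univ _ (Finset.mem_univ j)]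
    have h1 : ∑ k, l1n (M.updateRow j (Pi.single s 1) j k) = 1 := by
      rw [Finset.sum_eq_single s]
      · simp [l1n_one]
      · intro b _ hb
        simp [hb, l1n_zero]
      · simp
    rw [h1, one_mul]
    have h2 : ((Finset.univ : Finset S).erase j).card = Fintype.card S - 1 := by
      rw [Finset.card_erase_of_mem (Finset.mem_univ j), Finset.card_univ]
    rw [← h2, ← Finset.prod_const]
    refine Finset.prod_le_prod (fun i _ => Finset.sum_nonneg fun k _ => l1n_nonneg _) ?_
    intro i hi
    rw [Matrix.updateRow_ne (Finset.ne_of_mem_erase hi)]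
    exact hrow i
  refine ⟨∑ j, M.adjugate s j * C (q j), M.det, ?_, ?_, ?_⟩
  · refine (l1n_sum _ _).trans ?_
    rw [← Finset.card_univ, ← nsmul_eq_mul]
    refine Finset.sum_le_card_nsmul _ _ _ fun j _ => ?_
    rw [mul_comm, l1n_C_mul]
    refine mul_le_mul ?_ (by simpa using hadj j) (l1n_nonneg _) (by positivity)
    have := hqb j
    exact_mod_cast this
  · refine (l1n_det M).trans ?_
    rw [← Finset.card_univ, ← Finset.prod_const]
    exact Finset.prod_le_prod (fun i _ => Finset.sum_nonneg fun k _ => l1n_nonneg _)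
      fun i _ => hrow i
  · intro y hy0 hy1
    let φ : ℤ[X] →+* ℝ := (aeval y : ℤ[X] →ₐ[ℤ] ℝ).toRingHom
    set B : Matrix S S ℝ := (1 : Matrix S S ℝ) - (1 - y) • policyMatrix P π with hB
    have hmap : φ.mapMatrix M = (m : ℝ) • B := by
      ext i j
      have e0 : policyMatrix P π i j = (K i j : ℝ) / m := hK i j
      simp only [RingHom.mapMatrix_apply, Matrix.map_apply, hB, Matrix.smul_apply,
        Matrix.sub_apply, e0, Matrix.one_apply]
      change aeval y (C (if i = j then (m : ℤ) else 0) - C (K i j : ℤ) + C (K i j : ℤ) * X) = _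
      simp only [map_add, map_sub, map_mul, aeval_C, aeval_X, smul_eq_mul]
      split_ifs <;> simp <;> field_simp <;> ring
    have hBdet : B.det ≠ 0 := by
      apply det_ne_zero_of_sum_row_lt_diag
      intro i
      have hp := hk i (π i)
      have e1 : ∀ j ∈ Finset.univ.erase i, ‖B i j‖ = (1 - y) * P i (π i) j := by
        intro j hj
        have : i ≠ j := (Finset.ne_of_mem_erase hj).symm
        simp only [hB, Matrix.sub_apply, Matrix.one_apply_ne this, Matrix.smul_apply, zero_sub,
          norm_neg, smul_eq_mul]
        exact Real.norm_of_nonneg (mul_nonneg (by linarith) (hp.1 j))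
      rw [Finset.sum_congr rfl e1, ← Finset.mul_sum]
      have e2 := Finset.add_sum_erase Finset.univ (P i (π i)) (Finset.mem_univ i)
      rw [hp.2] at e2
      have e3 : B i i = 1 - (1 - y) * P i (π i) i := by
        simp [hB, policyMatrix]
      refine lt_of_lt_of_le ?_ (Real.le_norm_self _)
      rw [e3]
      nlinarith
    have hdet : aeval y M.det = ((m : ℝ) • B).det := by
      rw [← hmap, ← RingHom.map_det]; rfl
    have hdne : aeval y M.det ≠ 0 := by
      rw [hdet, Matrix.det_smul]
      exact mul_ne_zero (pow_ne_zero _ hm0.ne') hBdet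
    refine ⟨hdne, ?_⟩
    rw [eq_div_iff hdne]
    set v := valueFn r P π (1 - y) with hv
    have hBv : B *ᵥ v = policyReward r π := by
      rw [hv, valueFn, Matrix.mulVec_mulVec, Matrix.mul_nonsing_inv _ (isUnit_iff_ne_zero.2 hBdet),
        Matrix.one_mulVec]
    have hMv : ((m : ℝ) • B) *ᵥ v = fun j => (q j : ℝ) := by
      rw [Matrix.smul_mulVec, hBv]
      ext j
      simp only [Pi.smul_apply, policyReward, hq, smul_eq_mul]
      field_simp
    have hfin : ((m : ℝ) • B).adjugate *ᵥ (fun j => (q j : ℝ)) = ((m : ℝ) • B).det • v := by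
      rw [← hMv, Matrix.mulVec_mulVec, Matrix.adjugate_mul, Matrix.smul_mulVec,
        Matrix.one_mulVec]
    have := congrFun hfin s
    rw [hdet, mul_comm]
    simp only [Pi.smul_apply, smul_eq_mul] at this
    rw [← this, ← hmap, ← RingHom.map_adjugate, map_sum]
    simp only [Matrix.mulVec, dotProduct, map_mul, aeval_C]
    refine Finset.sum_congr rfl fun j _ => ?_
    simp [φ]

/-- Either order relation between two values is constant for `y` in `(0, η]`. -/
lemma order_const (n1 d1 n2 d2 : ℤ[X]) (η : ℝ) (hη1 : η ≤ 1)
    (hl : η * (l1n n1 * l1n d2 + l1n n2 * l1n d1) < 1) (u w : ℝ → ℝ)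
    (h1 : ∀ y : ℝ, 0 < y → y ≤ 1 → aeval y d1 ≠ 0 ∧ u y = aeval y n1 / aeval y d1)
    (h2 : ∀ y : ℝ, 0 < y → y ≤ 1 → aeval y d2 ≠ 0 ∧ w y = aeval y n2 / aeval y d2)
    (x y : ℝ) (hx : 0 < x) (hxη : x ≤ η) (hy : 0 < y) (hyη : y ≤ η) (hxw : u x ≤ w x) :
    u y ≤ w y := by
  by_contra! hlt
  set f := n1 * d2 - n2 * d1 with hf
  have key : ∀ z, 0 < z → z ≤ η → (u z - w z) * (aeval z d1 * aeval z d2) = aeval z f := by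
    intro z hz hzη
    obtain ⟨a1, b1⟩ := h1 z hz (hzη.trans hη1)
    obtain ⟨a2, b2⟩ := h2 z hz (hzη.trans hη1)
    rw [b1, b2, hf, map_sub, map_mul, map_mul]
    field_simp
  have hf0 : f ≠ 0 := by
    intro h0
    have := key y hy hyη
    rw [h0, map_zero] at this
    have := (mul_eq_zero.1 this).resolve_right
      (mul_ne_zero (h1 y hy (hyη.trans hη1)).1 (h2 y hy (hyη.trans hη1)).1)
    linarith
  have hcont : ContinuousOn (fun z => u z - w z) (Set.Ioc 0 η) := by
    have : ContinuousOn (fun z : ℝ => aeval z n1 / aeval z d1 - aeval z n2 / aeval z d2)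
        (Set.Ioc 0 η) := by
      refine ContinuousOn.sub (ContinuousOn.div ?_ ?_ ?_) (ContinuousOn.div ?_ ?_ ?_)
      · exact (Polynomial.continuous_aeval n1).continuousOn
      · exact (Polynomial.continuous_aeval d1).continuousOn
      · exact fun z hz => (h1 z hz.1 (hz.2.trans hη1)).1
      · exact (Polynomial.continuous_aeval n2).continuousOn
      · exact (Polynomial.continuous_aeval d2).continuousOn
      · exact fun z hz => (h2 z hz.1 (hz.2.trans hη1)).1
    refine this.congr fun z hz => ?_
    simp only [(h1 z hz.1 (hz.2.trans hη1)).2, (h2 z hz.1 (hz.2.trans hη1)).2]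
  obtain ⟨z, hz, hz0⟩ := isPreconnected_Ioc.intermediate_value
    (show x ∈ Set.Ioc 0 η from ⟨hx, hxη⟩) (show y ∈ Set.Ioc 0 η from ⟨hy, hyη⟩) hcont
    (show (0 : ℝ) ∈ Set.Icc (u x - w x) (u y - w y) from ⟨by linarith, by linarith⟩)
  have hk := key z hz.1 hz.2
  simp only at hz0
  rw [hz0, zero_mul] at hk
  refine noroot f z hz.1 (hz.2.trans hη1) hf0 ?_ hk.symm
  have hlf : l1n f ≤ l1n n1 * l1n d2 + l1n n2 * l1n d1 :=
    (l1n_sub _ _).trans (add_le_add (l1n_mul _ _) (l1n_mul _ _))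
  calc z * l1n f ≤ η * l1n f := mul_le_mul_of_nonneg_right hz.2 (l1n_nonneg _)
    _ ≤ η * (l1n n1 * l1n d2 + l1n n2 * l1n d1) :=
      mul_le_mul_of_nonneg_left hlf (hz.1.le.trans hz.2)
    _ < 1 := hl

lemma eta_bound (n m rinf : ℕ) (hn : 1 ≤ n) (hm : 1 ≤ m) (N : ℕ) (hN : N = 2 * n - 1) (L : ℝ)
    (hL : L = 2 * n * rinf * (m : ℝ) ^ (2 * n) * 4 ^ n) (η : ℝ)
    (hη : η = 1 / (2 * (N : ℝ) ^ ((N : ℝ) / 2 + 2) * (L + 1) ^ N)) :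
    0 < η ∧ η < 1 ∧
    η * (2 * ((n * (rinf * (3 * m : ℝ) ^ (n - 1))) * (3 * m : ℝ) ^ n)) < 1 := by
  have hN1 : 1 ≤ N := by omega
  have hL0 : 0 ≤ L := by rw [hL]; positivity
  have hm1 : (1 : ℝ) ≤ m := by exact_mod_cast hm
  have hn1 : (1 : ℝ) ≤ n := by exact_mod_cast hn
  have hNp : (1 : ℝ) ≤ (N : ℝ) ^ ((N : ℝ) / 2 + 2) :=
    Real.one_le_rpow (by exact_mod_cast hN1) (by positivity)
  have hLN : (1 : ℝ) ≤ (L + 1) ^ N := one_le_pow₀ (by linarith)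
  have hD : (L + 1) ^ N < 2 * (N : ℝ) ^ ((N : ℝ) / 2 + 2) * (L + 1) ^ N := by nlinarith
  have hD0 : 0 < 2 * (N : ℝ) ^ ((N : ℝ) / 2 + 2) * (L + 1) ^ N := by linarith
  refine ⟨by rw [hη]; positivity, by rw [hη, div_lt_one hD0]; linarith, ?_⟩
  rw [hη, one_div, inv_mul_lt_iff₀ hD0, mul_one]
  refine lt_of_le_of_lt ?_ hD
  have hB : 2 * ((n * (rinf * (3 * m : ℝ) ^ (n - 1))) * (3 * m : ℝ) ^ n) =
      2 * n * rinf * (3 * m : ℝ) ^ (2 * n - 1) := by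
    rw [show 2 * n - 1 = (n - 1) + n by omega, pow_add]; ring
  rw [hB]
  rcases Nat.eq_zero_or_pos rinf with h0 | h0
  · subst h0
    simp only [Nat.cast_zero, mul_zero, zero_mul]
    linarith
  have hr1 : (1 : ℝ) ≤ rinf := by exact_mod_cast h0
  rcases Nat.lt_or_ge n 2 with h2 | h2
  · obtain rfl : n = 1 := by omega
    obtain rfl : N = 1 := by omega
    rw [hL]
    norm_num
    have : (m : ℝ) ≤ m ^ 2 := by nlinarith
    have h3 : (rinf : ℝ) * m ≤ rinf * m ^ 2 := mul_le_mul_of_nonneg_left this (by linarith)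
    nlinarith
  · have hmp : (1 : ℝ) ≤ (m : ℝ) ^ (2 * n) := one_le_pow₀ hm1
    have a1 : (3 * m : ℝ) ^ (2 * n - 1) ≤ (m : ℝ) ^ (2 * n) * 4 ^ n * 4 ^ n := by
      calc (3 * m : ℝ) ^ (2 * n - 1) ≤ (3 * m : ℝ) ^ (2 * n) :=
            pow_le_pow_right₀ (by linarith) (by omega)
        _ ≤ (4 * m : ℝ) ^ (2 * n) := pow_le_pow_left₀ (by positivity) (by linarith) _
        _ = _ := by rw [mul_pow, two_mul n, pow_add (4 : ℝ)]; ring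
    have a2 : (4 : ℝ) ^ n ≤ L := by
      rw [hL]
      refine le_mul_of_one_le_left (by positivity) ?_
      have : (1 : ℝ) ≤ 2 * n := by linarith
      exact one_le_mul_of_one_le_of_one_le (one_le_mul_of_one_le_of_one_le this hr1) hmp
    calc 2 * n * rinf * (3 * m : ℝ) ^ (2 * n - 1)
        ≤ 2 * n * rinf * ((m : ℝ) ^ (2 * n) * 4 ^ n * 4 ^ n) :=
          mul_le_mul_of_nonneg_left a1 (by positivity)
      _ = L * 4 ^ n := by rw [hL]; ring
      _ ≤ L * L := mul_le_mul_of_nonneg_left a2 hL0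
      _ ≤ (L + 1) ^ 2 := by nlinarith
      _ ≤ (L + 1) ^ N := pow_le_pow_right₀ (by linarith) (by omega)

end aux

/-- Under the rationality assumption on every kernel in `U` (common denominator `m`, reward
numerators bounded by `r∞`), for every `γ ∈ [1 - η(M), 1)` a policy is robust `γ`-discounted
optimal iff it is robust Blackwell-optimal, where `N = 2|S| - 1`,
`L = 2 |S| r∞ m^{2|S|} 4^{|S|}` and `η(M) = 1 / (2 N^{N/2+2} (L+1)^N)`. -/
theorem robust_blackwell_discount_factor_le_one_sub_eta
    {S A : Type*} [Fintype S] [DecidableEq S] [Nonempty S] [Fintype A] [Nonempty A]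
    (r : S → A → ℝ) (U : Finset (S → A → S → ℝ)) (hU : U.Nonempty)
    (hkernel : ∀ P ∈ U, ∀ (s : S) (a : A), (∀ s', 0 ≤ P s a s') ∧ ∑ s', P s a s' = 1)
    (m rinf : ℕ) (hm : 1 ≤ m)
    (hPrat : ∀ P ∈ U, ∀ (s : S) (a : A) (s' : S),
      ∃ k : ℕ, k ≤ m ∧ P s a s' = (k : ℝ) / m)
    (hr : ∀ (s : S) (a : A), ∃ q : ℤ, r s a = (q : ℝ) / m ∧ |q| ≤ (rinf : ℤ))
    (N : ℕ) (hNdef : N = 2 * Fintype.card S - 1)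
    (L : ℝ)
    (hLdef : L = 2 * Fintype.card S * rinf *
      (m : ℝ) ^ (2 * Fintype.card S) * 4 ^ Fintype.card S)
    (η : ℝ) (hηdef : η = 1 / (2 * (N : ℝ) ^ ((N : ℝ) / 2 + 2) * (L + 1) ^ N)) :
    ∀ γ : ℝ, 1 - η ≤ γ → γ < 1 →
      ∀ π : S → A,
        RobustDiscountedOptimal r U hU γ π ↔ RobustBlackwellOptimal r U hU π := by
  have hn : 1 ≤ Fintype.card S := Fintype.card_pos
  obtain ⟨hη0, hη1, hηb⟩ := eta_bound (Fintype.card S) m rinf hn hm N hNdef L hLdef η hηdef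
  have hord : ∀ P ∈ U, ∀ P' ∈ U, ∀ (π π' : S → A) (s : S) (γ γ' : ℝ), 1 - η ≤ γ → γ < 1 →
      1 - η ≤ γ' → γ' < 1 → valueFn r P π γ s ≤ valueFn r P' π' γ s →
      valueFn r P π γ' s ≤ valueFn r P' π' γ' s := by
    intro P hP P' hP' π π' s γ γ' h1 h2 h3 h4 hle
    obtain ⟨n1, d1, a1, b1, c1⟩ :=
      value_poly r P π (hkernel P hP) m rinf hm (hPrat P hP) hr s
    obtain ⟨n2, d2, a2, b2, c2⟩ :=
      value_poly r P' π' (hkernel P' hP') m rinf hm (hPrat P' hP') hr s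
    have hl : η * (l1n n1 * l1n d2 + l1n n2 * l1n d1) < 1 := by
      refine lt_of_le_of_lt (mul_le_mul_of_nonneg_left ?_ hη0.le) hηb
      have e1 := mul_le_mul a1 b2 (l1n_nonneg _) (by positivity)
      have e2 := mul_le_mul a2 b1 (l1n_nonneg _) (by positivity)
      linarith
    have := order_const n1 d1 n2 d2 η hη1.le hl (fun y => valueFn r P π (1 - y) s)
      (fun y => valueFn r P' π' (1 - y) s) c1 c2 (1 - γ) (1 - γ') (by linarith) (by linarith)
      (by linarith) (by linarith) (by simpa using hle)
    simpa using this
  have hopt : ∀ (π : S → A) (γ γ' : ℝ), 1 - η ≤ γ → γ < 1 → 1 - η ≤ γ' → γ' < 1 →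
      RobustDiscountedOptimal r U hU γ π → RobustDiscountedOptimal r U hU γ' π := by
    intro π γ γ' h1 h2 h3 h4 h π' s
    have hs := h π' s
    unfold robustValueFn at hs ⊢
    rw [Finset.le_inf'_iff] at hs ⊢
    intro P hP
    obtain ⟨P', hP', hle⟩ := (Finset.inf'_le_iff hU).1 (hs P hP)
    exact (Finset.inf'_le_iff hU).2 ⟨P', hP', hord P' hP' P hP π' π s γ γ' h1 h2 h3 h4 hle⟩
  intro γ hγ hγ1 π
  constructor
  · intro h
    exact ⟨1 - η, by linarith, by linarith, fun γ' h1 h2 => hopt π γ γ' hγ hγ1 h1 h2 h⟩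
  · rintro ⟨γ₀, h0, h1, h⟩
    exact hopt π (max γ₀ (1 - η)) γ (le_max_right _ _) (max_lt h1 (by linarith)) hγ hγ1
      (h _ (le_max_left _ _) (max_lt h1 (by linarith)))
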